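/- arXiv:2010.08854 — 4 statements merged into one kernel-verified Lean document; each statement's English description precedes it below -/
import Mathlib

section
/- Let N ≥ 1, K ≥ 0, and let β : ℝ^N → ℝ be twice continuously differentiable with 0 ≤ β(x) ≤ 1, |∂ᵢβ(x)| ≤ K and |∂ᵢ∂ᵢβ(x)| ≤ K for all x and all i = 1,…,N. Then there exist c > 0 and μ₁ ≥ 1, depending only on N and K, such that for all real m ≥ 1, T ∈ (0,1), λ ≥ 1, μ ≥ μ₁ and all x ∈ ℝ^N, (4λ²μ² e^{μ(6m−4)} / T) · ( μ e^{6μ(m+1)} − e^{μ(β(x)+6m)} ) − Σᵢ₌₁^N [ (2λμ ∂ᵢβ(x) e^{μ(β(x)+6m)})² + 2λμ² (∂ᵢβ(x))² e^{μ(β(x)+6m)} + 2λμ ∂ᵢ∂ᵢβ(x) e^{μ(β(x)+6m)} ] ≥ c λ²μ³ e^{2μ(6m+1)}. -/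
/-- The partial derivative of `f : ℝ^N → ℝ` in the `i`-th coordinate direction. -/
noncomputable def pd {N : ℕ} (f : EuclideanSpace ℝ (Fin N) → ℝ) (i : Fin N)
    (x : EuclideanSpace ℝ (Fin N)) : ℝ :=
  fderiv ℝ f x (EuclideanSpace.single i 1)

/-- Bound on one summand `∂ᵢℓ² + ∂ᵢ∂ᵢℓ`, where `B` is the exponential weight and `E ≥ 1`
its upper bound. -/
theorem carleman_summand_le {K lam μ p q B E : ℝ} (hlam : 1 ≤ lam) (hμ : 1 ≤ μ)
    (hp : |p| ≤ K) (hq : |q| ≤ K) (hB : 0 ≤ B) (hBE : B ≤ E) (hE : 1 ≤ E) :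
    (2 * lam * μ * p * B) ^ 2 + 2 * lam * μ ^ 2 * p ^ 2 * B + 2 * lam * μ * q * B ≤
      lam ^ 2 * μ ^ 2 * E ^ 2 * (6 * K ^ 2 + 2 * K) := by
  have hK : 0 ≤ K := (abs_nonneg p).trans hp
  have hp2 : p ^ 2 ≤ K ^ 2 := sq_le_sq' (abs_le.mp hp).1 (abs_le.mp hp).2
  have hlam2 : lam ≤ lam ^ 2 := by nlinarith
  have hμ2 : μ ≤ μ ^ 2 := by nlinarith
  have hB2 : B ≤ E ^ 2 := by nlinarith
  have h_grad_sq : 4 * (lam ^ 2 * μ ^ 2 * p ^ 2 * B ^ 2) ≤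
      4 * (lam ^ 2 * μ ^ 2 * K ^ 2 * E ^ 2) := by gcongr
  have h_grad : 2 * (lam * μ ^ 2 * p ^ 2 * B) ≤ 2 * (lam ^ 2 * μ ^ 2 * K ^ 2 * E ^ 2) := by
    gcongr
  have h_hess : 2 * (lam * μ * B * q) ≤ 2 * (lam ^ 2 * μ ^ 2 * E ^ 2 * K) := by
    calc 2 * (lam * μ * B * q) ≤ 2 * (lam * μ * B * K) := by
          gcongr
          exact (abs_le.mp hq).2
      _ ≤ 2 * (lam ^ 2 * μ ^ 2 * E ^ 2 * K) := by gcongr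
  linarith

/-- Lower bound on the time-derivative term, where `A * D = E ^ 2` and `A`, `B` are bounded
by `E`. -/
theorem carleman_time_term_ge {T lam μ A B D E : ℝ} (hT : T ∈ Set.Ioo (0 : ℝ) 1)
    (hμ : 2 ≤ μ) (hB : 0 ≤ B) (hAE : A ≤ E) (hBE : B ≤ E)
    (hAD : A * D = E ^ 2) :
    2 * lam ^ 2 * μ ^ 3 * E ^ 2 ≤ 4 * lam ^ 2 * μ ^ 2 * A / T * (μ * D - B) := by
  have hAB : A * B ≤ E ^ 2 := by
    rw [sq]
    exact mul_le_mul hAE hBE hB (hB.trans hBE)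
  have h_half : μ * E ^ 2 / 2 ≤ μ * E ^ 2 - A * B := by nlinarith [sq_nonneg E]
  have h_prod : 2 * lam ^ 2 * μ ^ 3 * E ^ 2 ≤
      4 * lam ^ 2 * μ ^ 2 * (μ * E ^ 2 - A * B) := by
    calc 2 * lam ^ 2 * μ ^ 3 * E ^ 2 = 4 * lam ^ 2 * μ ^ 2 * (μ * E ^ 2 / 2) := by ring
      _ ≤ _ := by gcongr
  have h_nonneg : 0 ≤ 2 * lam ^ 2 * μ ^ 3 * E ^ 2 := by positivity
  calc 2 * lam ^ 2 * μ ^ 3 * E ^ 2 ≤ 4 * lam ^ 2 * μ ^ 2 * (μ * E ^ 2 - A * B) := h_prod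
    _ ≤ 4 * lam ^ 2 * μ ^ 2 * (μ * E ^ 2 - A * B) / T :=
        le_div_self (h_nonneg.trans h_prod) hT.1 hT.2.le
    _ = 4 * lam ^ 2 * μ ^ 2 * A / T * (μ * D - B) := by
        rw [← hAD]
        ring

/-- Positivity at `t = 0` of `∂ₜℓ(0,x) - Σᵢ (∂ᵢℓ(0,x)² + ∂ᵢ∂ᵢℓ(0,x))` for the
Carleman weight exponent, with constants `c` and `μ₁` depending only on `N` and `K`. -/
theorem carleman_initial_time_positivity
    (N : ℕ) (hN : 1 ≤ N) (K : ℝ) (hK : 0 ≤ K) :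
    ∃ c > (0 : ℝ), ∃ μ₁ ≥ (1 : ℝ),
      ∀ β : EuclideanSpace ℝ (Fin N) → ℝ, ContDiff ℝ 2 β →
      (∀ x, 0 ≤ β x ∧ β x ≤ 1) →
      (∀ x, ∀ i : Fin N, |pd β i x| ≤ K) →
      (∀ x, ∀ i : Fin N, |pd (pd β i) i x| ≤ K) →
      ∀ m T lam μ : ℝ, 1 ≤ m → T ∈ Set.Ioo (0 : ℝ) 1 → 1 ≤ lam → μ₁ ≤ μ →
      ∀ x : EuclideanSpace ℝ (Fin N),
        c * lam ^ 2 * μ ^ 3 * Real.exp (2 * μ * (6 * m + 1)) ≤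
          4 * lam ^ 2 * μ ^ 2 * Real.exp (μ * (6 * m - 4)) / T *
            (μ * Real.exp (6 * μ * (m + 1)) - Real.exp (μ * (β x + 6 * m))) -
          ∑ i : Fin N,
            ((2 * lam * μ * pd β i x * Real.exp (μ * (β x + 6 * m))) ^ 2 +
              2 * lam * μ ^ 2 * (pd β i x) ^ 2 * Real.exp (μ * (β x + 6 * m)) +
              2 * lam * μ * pd (pd β i) i x * Real.exp (μ * (β x + 6 * m))) := by
  have hC : 0 ≤ N * (6 * K ^ 2 + 2 * K) := by positivity
  refine ⟨1, one_pos, 2 + N * (6 * K ^ 2 + 2 * K), by linarith, ?_⟩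
  intro β _ hβ hβ₁ hβ₂ m T lam μ hm hT hlam hμ x
  have hμ2 : 2 ≤ μ := by linarith
  have hE_sq : Real.exp (2 * μ * (6 * m + 1)) = Real.exp (μ * (6 * m + 1)) ^ 2 := by
    rw [sq, ← Real.exp_add]
    ring_nf
  have hAD : Real.exp (μ * (6 * m - 4)) * Real.exp (6 * μ * (m + 1)) =
      Real.exp (μ * (6 * m + 1)) ^ 2 := by
    rw [sq, ← Real.exp_add, ← Real.exp_add]
    ring_nf
  have hAE : Real.exp (μ * (6 * m - 4)) ≤ Real.exp (μ * (6 * m + 1)) :=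
    Real.exp_le_exp.mpr (by nlinarith)
  have hBE : Real.exp (μ * (β x + 6 * m)) ≤ Real.exp (μ * (6 * m + 1)) :=
    Real.exp_le_exp.mpr (by nlinarith [(hβ x).2])
  have hE : 1 ≤ Real.exp (μ * (6 * m + 1)) := Real.one_le_exp (by positivity)
  have h_time := carleman_time_term_ge (lam := lam) hT hμ2 (Real.exp_nonneg _) hAE hBE hAD
  have h_sum := Finset.sum_le_sum fun (i : Fin N) (_ : i ∈ Finset.univ) =>
    carleman_summand_le (μ := μ) hlam (by linarith) (hβ₁ x i) (hβ₂ x i) (Real.exp_nonneg _) hBE hE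
  rw [Finset.sum_const, Finset.card_univ, Fintype.card_fin, nsmul_eq_mul] at h_sum
  rw [hE_sq]
  set E := Real.exp (μ * (6 * m + 1))
  have h_absorb : lam ^ 2 * μ ^ 2 * E ^ 2 * (N * (6 * K ^ 2 + 2 * K)) ≤
      lam ^ 2 * μ ^ 2 * E ^ 2 * μ := by
    gcongr
    linarith
  linarith
end

section
/- Let N ≥ 1 and let D′ and D₀ be open subsets of ℝ^N such that the closure of D′ is compact and contained in D₀. Then there exist an infinitely differentiable function η : ℝ^N → ℝ with compact support contained in D₀ and a constant C > 0 such that 0 ≤ η(x) ≤ 1 for all x, η(x) = 1 for all x ∈ D′, and |∇η(x)| ≤ C √(η(x)) for all x ∈ ℝ^N. -/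
/-- A compact set inside an open set of a finite-dimensional space admits a smooth cut-off with
values in `[0, 1]`. -/
theorem IsCompact.exists_contDiff_cutoff {E : Type*} [NormedAddCommGroup E] [NormedSpace ℝ E]
    [FiniteDimensional ℝ E] {K U : Set E} (hK : IsCompact K) (hU : IsOpen U) (hKU : K ⊆ U) :
    ∃ φ : E → ℝ, ContDiff ℝ (⊤ : ℕ∞) φ ∧ HasCompactSupport φ ∧ tsupport φ ⊆ U ∧
      (∀ x, 0 ≤ φ x ∧ φ x ≤ 1) ∧ ∀ x ∈ K, φ x = 1 := by
  obtain ⟨L, hL, hKL, hLU⟩ := exists_compact_between hK hU hKU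
  obtain ⟨φ, hφ, hrange, hsupp, hone⟩ := exists_contMDiff_support_eq_eq_one_iff
    (modelWithCornersSelf ℝ E) isOpen_interior hK.isClosed hKL
  have htsupp : tsupport φ ⊆ L :=
    closure_minimal (hsupp.trans_subset interior_subset) hL.isClosed
  exact ⟨φ, hφ.contDiff, hL.of_isClosed_subset (isClosed_tsupport φ) htsupp, htsupp.trans hLU,
    fun x => hrange (Set.mem_range_self x), fun x hx => (hone x).1 hx⟩

/-- The square of a compactly supported `C¹` function has gradient bounded by a multiple of its
square root. -/
theorem HasCompactSupport.exists_norm_gradient_sq_le {E : Type*} [NormedAddCommGroup E]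
    [InnerProductSpace ℝ E] [CompleteSpace E] {φ : E → ℝ} (hsupp : HasCompactSupport φ)
    (hφ : ContDiff ℝ 1 φ) :
    ∃ C > (0 : ℝ), ∀ x, ‖gradient (fun y => φ y ^ 2) x‖ ≤ C * Real.sqrt (φ x ^ 2) := by
  obtain ⟨M, hM⟩ :=
    (hsupp.fderiv ℝ).exists_bound_of_continuous (hφ.continuous_fderiv one_ne_zero)
  have hM0 : 0 ≤ M := (norm_nonneg _).trans (hM 0)
  refine ⟨2 * M + 1, by positivity, fun x => ?_⟩
  have hd := (((hφ.differentiable one_ne_zero) x).hasFDerivAt.pow 2).fderiv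
  rw [gradient, LinearIsometryEquiv.norm_map, hd, Real.sqrt_sq_eq_abs]
  simp only [norm_smul, Nat.add_one_sub_one, pow_one, nsmul_eq_mul, Nat.cast_ofNat, norm_mul,
    Real.norm_eq_abs, Nat.abs_ofNat]
  nlinarith [mul_le_mul_of_nonneg_left (hM x) (abs_nonneg (φ x)), abs_nonneg (φ x)]

/-- Existence of a smooth cut-off `η` with compact support in `D₀`, `0 ≤ η ≤ 1`,
`η ≡ 1` on `D'`, and `|∇η| ≤ C √η`. -/
theorem exists_smooth_cutoff_with_sqrt_gradient_bound
    (N : ℕ) (hN : 1 ≤ N) (D' D₀ : Set (EuclideanSpace ℝ (Fin N)))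
    (hD'open : IsOpen D') (hD₀open : IsOpen D₀)
    (hD'cpt : IsCompact (closure D')) (hsub : closure D' ⊆ D₀) :
    ∃ η : EuclideanSpace ℝ (Fin N) → ℝ, ∃ C > (0 : ℝ),
      ContDiff ℝ (⊤ : ℕ∞) η ∧ HasCompactSupport η ∧ tsupport η ⊆ D₀ ∧
      (∀ x, 0 ≤ η x ∧ η x ≤ 1) ∧ (∀ x ∈ D', η x = 1) ∧
      (∀ x, ‖gradient η x‖ ≤ C * Real.sqrt (η x)) := by
  obtain ⟨φ, hφ, hcpt, hφsupp, hrange, hone⟩ :=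
    hD'cpt.exists_contDiff_cutoff hD₀open hsub
  obtain ⟨C, hC, hgrad⟩ := hcpt.exists_norm_gradient_sq_le (hφ.of_le (by simp))
  have hsupp_sq : Function.support (fun x => φ x ^ 2) = Function.support φ :=
    Function.support_pow' φ two_ne_zero
  have htsupp : tsupport (fun x => φ x ^ 2) = tsupport φ := congrArg closure hsupp_sq
  refine ⟨fun x => φ x ^ 2, C, hC, hφ.pow 2, ?_, htsupp.trans_subset hφsupp,
    fun x => ⟨sq_nonneg _, pow_le_one₀ (hrange x).1 (hrange x).2⟩, fun x hx => ?_, hgrad⟩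
  · rw [HasCompactSupport, htsupp]
    exact hcpt
  · simp [hone x (subset_closure hx)]
end

section
/- Let N ≥ 1 and let ℓ, ψ, A : ℝ^N → ℝ be such that ℓ and ψ are twice continuously differentiable and A is continuously differentiable. Set I := Aψ + Δψ, where Δψ = Σᵢ ∂ᵢ∂ᵢψ. Then at every point of ℝ^N one has the identity −2 Σᵢ (∂ᵢℓ)(∂ᵢψ) I = − Σᵢ ∂ᵢ( A (∂ᵢℓ) ψ² ) + Σᵢ ∂ᵢ( A ∂ᵢℓ ) ψ² − Σᵢ ∂ᵢ( Σⱼ ( 2(∂ⱼℓ)(∂ᵢψ)(∂ⱼψ) − (∂ᵢℓ)(∂ⱼψ)² ) ) + 2 Σᵢ Σⱼ (∂ᵢ∂ⱼℓ)(∂ᵢψ)(∂ⱼψ) − (Δℓ) |∇ψ|², where Δℓ = Σₖ ∂ₖ∂ₖℓ and |∇ψ|² = Σⱼ (∂ⱼψ)². -/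
section PartialDerivative

variable {N : ℕ} {f g : EuclideanSpace ℝ (Fin N) → ℝ} {x : EuclideanSpace ℝ (Fin N)}

theorem pd_mul (hf : DifferentiableAt ℝ f x) (hg : DifferentiableAt ℝ g x) (i : Fin N) :
    pd (fun y => f y * g y) i x = pd f i x * g x + f x * pd g i x := by
  simp only [pd, fderiv_fun_mul hf hg, add_apply, smul_apply, smul_eq_mul]
  ring

theorem pd_sub (hf : DifferentiableAt ℝ f x) (hg : DifferentiableAt ℝ g x) (i : Fin N) :
    pd (fun y => f y - g y) i x = pd f i x - pd g i x := by
  simp only [pd, fderiv_fun_sub hf hg, sub_apply]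

theorem pd_const_mul (hf : DifferentiableAt ℝ f x) (c : ℝ) (i : Fin N) :
    pd (fun y => c * f y) i x = c * pd f i x := by
  simp only [pd, fderiv_const_mul hf, smul_apply, smul_eq_mul]

theorem pd_sq (hf : DifferentiableAt ℝ f x) (i : Fin N) :
    pd (fun y => f y ^ 2) i x = 2 * f x * pd f i x := by
  simp only [pow_two, pd_mul hf hf]
  ring

theorem pd_sum {ι : Type*} {s : Finset ι} {F : ι → EuclideanSpace ℝ (Fin N) → ℝ}
    (hF : ∀ j ∈ s, DifferentiableAt ℝ (F j) x) (i : Fin N) :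
    pd (fun y => ∑ j ∈ s, F j y) i x = ∑ j ∈ s, pd (F j) i x := by
  simp only [pd, fderiv_fun_sum hF, sum_apply]

theorem ContDiff.differentiable_pd (hf : ContDiff ℝ 2 f) (i : Fin N) :
    Differentiable ℝ (pd f i) :=
  ((hf.fderiv_right (m := 1) (by norm_num)).differentiable (by norm_num)).clm_apply
    (differentiable_const _)

/-- Symmetry of second partial derivatives. -/
theorem ContDiff.pd_comm (hf : ContDiff ℝ 2 f) (i j : Fin N) (x : EuclideanSpace ℝ (Fin N)) :
    pd (pd f i) j x = pd (pd f j) i x := by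
  have hd : DifferentiableAt ℝ (fderiv ℝ f) x :=
    (hf.fderiv_right (m := 1) (by norm_num)).differentiable (by norm_num) x
  have key (k l : Fin N) : pd (pd f k) l x =
      fderiv ℝ (fderiv ℝ f) x (EuclideanSpace.single l 1) (EuclideanSpace.single k 1) := by
    change fderiv ℝ (fun y => fderiv ℝ f y (EuclideanSpace.single k 1)) x _ = _
    simp [fderiv_clm_apply hd (differentiableAt_const _)]
  rw [key, key]
  exact hf.contDiffAt.isSymmSndFDerivAt (by simp) _ _

end PartialDerivative

/-- The pointwise algebraic identity underlying the weighted identity method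
for Carleman estimates:  with `I = A ψ + Δψ`,
`-2 Σᵢ ∂ᵢℓ ∂ᵢψ I = -Σᵢ ∂ᵢ(A ∂ᵢℓ ψ²) + Σᵢ ∂ᵢ(A ∂ᵢℓ) ψ²
  - Σᵢ ∂ᵢ(Σⱼ (2 ∂ⱼℓ ∂ᵢψ ∂ⱼψ - ∂ᵢℓ (∂ⱼψ)²)) + 2 Σᵢ Σⱼ ∂ᵢ∂ⱼℓ ∂ᵢψ ∂ⱼψ - Δℓ |∇ψ|²`. -/
theorem weighted_identity_pointwise
    (N : ℕ) (hN : 1 ≤ N)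
    (ℓ ψ A : EuclideanSpace ℝ (Fin N) → ℝ)
    (hℓ : ContDiff ℝ 2 ℓ) (hψ : ContDiff ℝ 2 ψ) (hA : ContDiff ℝ 1 A)
    (x : EuclideanSpace ℝ (Fin N)) :
    -2 * ∑ i : Fin N, pd ℓ i x * pd ψ i x *
        (A x * ψ x + ∑ k : Fin N, pd (pd ψ k) k x) =
      -(∑ i : Fin N, pd (fun y => A y * pd ℓ i y * (ψ y) ^ 2) i x) +
        (∑ i : Fin N, pd (fun y => A y * pd ℓ i y) i x) * (ψ x) ^ 2 -
        (∑ i : Fin N, pd (fun y => ∑ j : Fin N,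
          (2 * pd ℓ j y * pd ψ i y * pd ψ j y - pd ℓ i y * (pd ψ j y) ^ 2)) i x) +
        2 * (∑ i : Fin N, ∑ j : Fin N, pd (pd ℓ j) i x * pd ψ i x * pd ψ j x) -
        (∑ k : Fin N, pd (pd ℓ k) k x) * (∑ j : Fin N, (pd ψ j x) ^ 2) := by
  have dψ : DifferentiableAt ℝ ψ x := hψ.differentiable (by norm_num) x
  have dA : DifferentiableAt ℝ A x := hA.differentiable (by norm_num) x
  have dℓ' (i : Fin N) : DifferentiableAt ℝ (pd ℓ i) x := hℓ.differentiable_pd i x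
  have dψ' (i : Fin N) : DifferentiableAt ℝ (pd ψ i) x := hψ.differentiable_pd i x
  have hzero (i : Fin N) : pd (fun y => A y * pd ℓ i y * ψ y ^ 2) i x =
      pd (fun y => A y * pd ℓ i y) i x * ψ x ^ 2 +
        2 * (pd ℓ i x * pd ψ i x * (A x * ψ x)) := by
    rw [pd_mul (dA.fun_mul (dℓ' i)) (dψ.fun_pow 2), pd_sq dψ]
    ring
  have hgrad (i : Fin N) : pd (fun y => ∑ j : Fin N,
      (2 * pd ℓ j y * pd ψ i y * pd ψ j y - pd ℓ i y * pd ψ j y ^ 2)) i x =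
      ∑ j : Fin N, (2 * (pd (pd ℓ j) i x * pd ψ i x * pd ψ j x) +
        2 * (pd ℓ j x * pd ψ j x * pd (pd ψ i) i x) +
        2 * (pd ℓ j x * pd ψ i x * pd (pd ψ j) i x) -
        pd (pd ℓ i) i x * pd ψ j x ^ 2 -
        2 * (pd ℓ i x * pd ψ j x * pd (pd ψ j) i x)) := by
    rw [pd_sum fun j _ => by fun_prop]
    refine Finset.sum_congr rfl fun j _ => ?_
    rw [pd_sub ((((dℓ' j).const_mul 2).fun_mul (dψ' i)).fun_mul (dψ' j))
        ((dℓ' i).fun_mul ((dψ' j).fun_pow 2)),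
      pd_mul (((dℓ' j).const_mul 2).fun_mul (dψ' i)) (dψ' j),
      pd_mul ((dℓ' j).const_mul 2) (dψ' i), pd_const_mul (dℓ' j),
      pd_mul (dℓ' i) ((dψ' j).fun_pow 2), pd_sq (dψ' j)]
    ring
  have hcross : ∑ i : Fin N, ∑ j : Fin N, pd ℓ j x * pd ψ i x * pd (pd ψ j) i x =
      ∑ i : Fin N, ∑ j : Fin N, pd ℓ i x * pd ψ j x * pd (pd ψ j) i x := by
    rw [Finset.sum_comm]
    simp only [fun i j => hψ.pd_comm i j x]
  simp only [hzero, hgrad]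
  simp only [mul_add, Finset.sum_add_distrib, Finset.sum_sub_distrib,
    ← Finset.mul_sum, ← Finset.sum_mul]
  linear_combination 2 * hcross
end

section
/- Let m ≥ 1, μ ≥ 1, λ ≥ 1 and b ∈ [0,1] be real numbers. Let I ⊂ ℝ be an interval and let γ : I → ℝ be differentiable with γ(t) ≥ 1 and γ′(t) ≥ 0 for all t ∈ I. Define φ(t) = γ(t)( e^{μ(b+6m)} − μ e^{6μ(m+1)} ), ξ(t) = γ(t) e^{μ(b+6m)} and θ(t) = e^{λφ(t)}. Then for every t ∈ I, the derivative of the function s ↦ θ(s)^{−2} λ^{−2} ξ(s)^{−2} at t satisfies d/dt ( θ(t)^{−2} λ^{−2} ξ(t)^{−2} ) ≥ λ^{−1} θ(t)^{−2} ξ(t)^{−2} ( γ′(t)/γ(t) ) |φ(t)|. -/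
/-- The spatial factor `e^{μ(b+6m)} - μ e^{6μ(m+1)}` of the Carleman weight is at most `-2`. -/
theorem carleman_spatial_factor_le_neg_two {m μ b : ℝ} (hm : 0 ≤ m) (hμ : 1 ≤ μ)
    (hb0 : 0 ≤ b) (hb1 : b ≤ 1) :
    Real.exp (μ * (b + 6 * m)) - μ * Real.exp (6 * μ * (m + 1)) ≤ -2 := by
  have hE : 1 ≤ Real.exp (μ * (b + 6 * m)) := Real.one_le_exp (by positivity)
  have hsplit : Real.exp (6 * μ * (m + 1)) =
      Real.exp (μ * (b + 6 * m)) * Real.exp (μ * (6 - b)) := by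
    rw [← Real.exp_add]; ring_nf
  have hgap : 3 ≤ Real.exp (μ * (6 - b)) := by
    have := Real.add_one_le_exp (μ * (6 - b))
    nlinarith
  have hmul : Real.exp (6 * μ * (m + 1)) ≤ μ * Real.exp (6 * μ * (m + 1)) :=
    le_mul_of_one_le_left (Real.exp_pos _).le hμ
  nlinarith

/-- Derivative of the inverse-square weight `(e^{λ γ K})^{-2} λ^{-2} (γ E)^{-2}`. -/
theorem hasDerivAt_inv_sq_weight {γ : ℝ → ℝ} {γ' t lam K E : ℝ} (hlam : lam ≠ 0) (hE : E ≠ 0)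
    (hγ : γ t ≠ 0) (h : HasDerivAt γ γ' t) :
    HasDerivAt (fun s => (Real.exp (lam * (γ s * K)) ^ 2)⁻¹ * (lam ^ 2)⁻¹ * ((γ s * E) ^ 2)⁻¹)
      ((Real.exp (lam * (γ t * K)) ^ 2)⁻¹ * (lam ^ 2)⁻¹ * ((γ t * E) ^ 2)⁻¹ *
        (2 * γ' * (-(lam * K) - 1 / γ t))) t := by
  have hθ := (((h.mul_const K).const_mul lam).exp.fun_pow 2).fun_inv
    (pow_ne_zero 2 (Real.exp_ne_zero _))
  have hξ := ((h.mul_const E).fun_pow 2).fun_inv (pow_ne_zero 2 (mul_ne_zero hγ hE))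
  refine ((hθ.mul_const (lam ^ 2)⁻¹).fun_mul hξ).congr_deriv ?_
  have := Real.exp_ne_zero (lam * (γ t * K))
  field_simp
  ring

/-- Sign property of the time derivative of the inverse-square Carleman weight
`θ^{-2} λ^{-2} ξ^{-2}` on an interval where the time factor `γ` is nondecreasing
and at least `1`.  Here `b` plays the role of `β(x) ∈ [0,1]`,
`φ(t) = γ(t) (e^{μ(b+6m)} - μ e^{6μ(m+1)})`, `ξ(t) = γ(t) e^{μ(b+6m)}` and
`θ(t) = e^{λ φ(t)}`. -/
theorem deriv_inv_sq_carleman_weight_lower_bound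
    (m μ lam b : ℝ) (hm : 1 ≤ m) (hμ : 1 ≤ μ) (hlam : 1 ≤ lam)
    (hb : b ∈ Set.Icc (0 : ℝ) 1)
    (I : Set ℝ) (hI : I.OrdConnected)
    (γ γ' : ℝ → ℝ)
    (hdiff : ∀ t ∈ I, HasDerivAt γ (γ' t) t)
    (hγ1 : ∀ t ∈ I, 1 ≤ γ t) (hγ'0 : ∀ t ∈ I, 0 ≤ γ' t) :
    ∀ t ∈ I,
      lam⁻¹ *
          ((Real.exp (lam * (γ t * (Real.exp (μ * (b + 6 * m)) -
              μ * Real.exp (6 * μ * (m + 1))))) ^ 2)⁻¹ *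
            ((γ t * Real.exp (μ * (b + 6 * m))) ^ 2)⁻¹) *
          (γ' t / γ t) *
          |γ t * (Real.exp (μ * (b + 6 * m)) - μ * Real.exp (6 * μ * (m + 1)))| ≤
        deriv (fun s : ℝ =>
          (Real.exp (lam * (γ s * (Real.exp (μ * (b + 6 * m)) -
              μ * Real.exp (6 * μ * (m + 1))))) ^ 2)⁻¹ *
            (lam ^ 2)⁻¹ * ((γ s * Real.exp (μ * (b + 6 * m))) ^ 2)⁻¹) t := by
  intro t ht
  have hγ : 0 < γ t := one_pos.trans_le (hγ1 t ht)
  have hlam0 : 0 < lam := one_pos.trans_le hlam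
  have hE := Real.exp_pos (μ * (b + 6 * m))
  have hK := carleman_spatial_factor_le_neg_two (zero_le_one.trans hm) hμ hb.1 hb.2
  rw [(hasDerivAt_inv_sq_weight hlam0.ne' hE.ne' hγ.ne' (hdiff t ht)).deriv]
  generalize Real.exp (μ * (b + 6 * m)) - μ * Real.exp (6 * μ * (m + 1)) = K at *
  generalize Real.exp (μ * (b + 6 * m)) = E at *
  have hbracket : γ' t * (lam * -K) ≤ 2 * γ' t * (-(lam * K) - 1 / γ t) := by
    have hinv : 1 / γ t ≤ 1 := (div_le_one hγ).2 (hγ1 t ht)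
    have hlamK : 2 ≤ lam * -K := by nlinarith
    have := mul_nonneg (hγ'0 t ht) (by linarith : 0 ≤ lam * -K - 2 * (1 / γ t))
    linarith
  rw [abs_of_nonpos (mul_nonpos_of_nonneg_of_nonpos hγ.le (by linarith))]
  refine le_of_eq_of_le ?_ (mul_le_mul_of_nonneg_left hbracket (by positivity))
  field_simp
end
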